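/- Let q ≥ 2, d ≥ 2 with d dividing q−1, and let a, j be integers with 0 ≤ a < d and 0 ≤ j < q. For k ≥ 1 set E_{a,j}(k) = #{0 ≤ n < q^k : n ≡ a (mod d) and s_q(n) ≡ j (mod q)}. Then there exist a real number R > 1 and a constant c > 0 such that E_{a,j}(k) − q^{k−1}/d > c·R^k for infinitely many k, and E_{a,j}(k) − q^{k−1}/d < −c·R^k for infinitely many k. -/

import Mathlib

/-- The ratio `sin (n x) / sin x` is strictly decreasing for `0 < x ≤ π / n`. -/
lemma sin_nat_mul_mul_sin_lt {x y : ℝ} (hx : 0 < x) (hxy : x < y) {n : ℕ} (hn : 2 ≤ n)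
    (hy : n * y ≤ Real.pi) :
    Real.sin (n * y) * Real.sin x < Real.sin (n * x) * Real.sin y := by
  have step : ∀ k : ℕ, 1 ≤ k → ((k + 1 : ℕ) : ℝ) * y ≤ Real.pi →
      Real.sin (k * y) * Real.sin x ≤ Real.sin (k * x) * Real.sin y →
      Real.sin ((k + 1 : ℕ) * y) * Real.sin x < Real.sin ((k + 1 : ℕ) * x) * Real.sin y := by
    intro k hk hky ih
    push_cast at hky ⊢
    have hk1 : (1 : ℝ) ≤ k := by exact_mod_cast hk
    have hy0 : 0 < y := hx.trans hxy
    have hyk : y ≤ k * y := le_mul_of_one_le_left hy0.le hk1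
    have hsx : 0 < Real.sin x := Real.sin_pos_of_pos_of_lt_pi hx (by linarith)
    have hsy : 0 < Real.sin y := Real.sin_pos_of_pos_of_lt_pi hy0 (by linarith)
    have hskx : 0 ≤ Real.sin (k * x) :=
      Real.sin_nonneg_of_nonneg_of_le_pi (by positivity) (by nlinarith)
    have hcy : 0 ≤ Real.cos y := Real.cos_nonneg_of_mem_Icc ⟨by linarith, by linarith⟩
    have hcxy : Real.cos y ≤ Real.cos x :=
      (Real.cos_lt_cos_of_nonneg_of_le_pi hx.le (by linarith) hxy).le
    have hck : Real.cos (k * y) < Real.cos (k * x) :=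
      Real.cos_lt_cos_of_nonneg_of_le_pi (by positivity) (by linarith) (by nlinarith)
    rw [add_mul, add_mul, one_mul, one_mul, Real.sin_add, Real.sin_add]
    have h1 := mul_le_mul_of_nonneg_right ih hcy
    have h2 := mul_le_mul_of_nonneg_left hcxy (mul_nonneg hskx hsy.le)
    have h3 := mul_lt_mul_of_pos_right hck (mul_pos hsx hsy)
    linarith
  have weak : ∀ k : ℕ, 1 ≤ k → (k : ℝ) * y ≤ Real.pi →
      Real.sin (k * y) * Real.sin x ≤ Real.sin (k * x) * Real.sin y := by
    intro k hk
    induction k, hk using Nat.le_induction with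
    | base => intro _; simp [mul_comm]
    | succ k hk ih =>
      intro h
      refine (step k hk h (ih ?_)).le
      push_cast at h
      linarith
  obtain ⟨k, rfl⟩ : ∃ k, n = k + 1 := ⟨n - 1, by omega⟩
  refine step k (by omega) hy (weak k (by omega) ?_)
  push_cast at hy
  linarith

lemma abs_sin_nat_mul_mul_sin_lt {x y : ℝ} {n : ℕ} (hn : 2 ≤ n) (hx : 0 < x)
    (hnx : 2 * (n * x) ≤ Real.pi) (hxy : x < y) (hy : y ≤ Real.pi / 2) :
    |Real.sin (n * y)| * Real.sin x < Real.sin (n * x) * Real.sin y := by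
  have hn2 : (2 : ℝ) ≤ n := by exact_mod_cast hn
  have hn0 : (0 : ℝ) < n := by linarith
  rcases le_or_gt (n * y) Real.pi with h | h
  · rw [abs_of_nonneg (Real.sin_nonneg_of_nonneg_of_le_pi
      (mul_nonneg hn0.le (hx.trans hxy).le) h)]
    exact sin_nat_mul_mul_sin_lt hx hxy hn h
  · set z := Real.pi / (2 * n) with hz
    have hnz : n * z = Real.pi / 2 := by rw [hz]; field_simp
    have hxz : x ≤ z := by
      rw [hz, le_div_iff₀ (by positivity)]; linarith
    have hzy : z < y := by
      have : n * z < n * y := by rw [hnz]; linarith [Real.pi_pos]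
      exact lt_of_mul_lt_mul_left this hn0.le
    have hsx : 0 < Real.sin x :=
      Real.sin_pos_of_pos_of_lt_pi hx (by linarith [Real.pi_pos])
    have h1 : Real.sin x ≤ Real.sin (n * x) * Real.sin z := by
      rcases hxz.eq_or_lt with h' | h'
      · rw [h', hnz, Real.sin_pi_div_two, one_mul]
      · have := sin_nat_mul_mul_sin_lt hx h' hn (by rw [hnz]; linarith [Real.pi_pos])
        rw [hnz, Real.sin_pi_div_two, one_mul] at this
        exact this.le
    have hsnx : 0 < Real.sin (n * x) :=
      Real.sin_pos_of_pos_of_lt_pi (by positivity) (by linarith [Real.pi_pos, mul_pos hn0 hx])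
    have h2 : Real.sin z < Real.sin y :=
      Real.sin_lt_sin_of_lt_of_le_pi_div_two (by linarith [Real.pi_pos]) hy hzy
    calc |Real.sin (n * y)| * Real.sin x ≤ 1 * Real.sin x :=
          mul_le_mul_of_nonneg_right (Real.abs_sin_le_one _) hsx.le
      _ = Real.sin x := one_mul _
      _ ≤ Real.sin (n * x) * Real.sin z := h1
      _ < Real.sin (n * x) * Real.sin y := mul_lt_mul_of_pos_left h2 hsnx

lemma Finset.sum_range_mul_eq_sum_sum {M : Type*} [AddCommMonoid M] (q N : ℕ) (f : ℕ → M) :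
    ∑ n ∈ Finset.range (q * N), f n =
      ∑ n ∈ Finset.range N, ∑ r ∈ Finset.range q, f (r + q * n) := by
  induction N with
  | zero => simp
  | succ N ih =>
    rw [Nat.mul_succ, Finset.sum_range_add, ih, Finset.sum_range_succ]
    simp only [add_comm]

lemma sum_pow_digits_sum {K : Type*} [CommRing K] {q : ℕ} (hq : 2 ≤ q) (z : K) (k : ℕ) :
    ∑ n ∈ Finset.range (q ^ k), z ^ (Nat.digits q n).sum =
      (∑ r ∈ Finset.range q, z ^ r) ^ k := by
  induction k with
  | zero => simp
  | succ k ih =>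
    rw [pow_succ', Finset.sum_range_mul_eq_sum_sum, pow_succ, ← ih, Finset.sum_mul]
    refine Finset.sum_congr rfl fun n _ => ?_
    rw [Finset.mul_sum]
    refine Finset.sum_congr rfl fun r hr => ?_
    have hr' := Finset.mem_range.mp hr
    have : (Nat.digits q (r + q * n)).sum = (Nat.digits q n).sum + r := by
      rcases Nat.eq_zero_or_pos (r + q * n) with h0 | h0
      · have hr0 : r = 0 := by omega
        have hn0 : n = 0 := by
          have : q * n = 0 := by omega
          rcases Nat.mul_eq_zero.mp this with h | h <;> omega
        simp [hr0, hn0]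
      · rw [Nat.digits_def' (by omega) h0, List.sum_cons, Nat.add_mul_mod_self_left,
          Nat.mod_eq_of_lt hr', Nat.add_mul_div_left _ _ (by omega), Nat.div_eq_of_lt hr',
          zero_add, add_comm]
    rw [this, pow_add]

lemma sum_pow_of_pow_eq_one {K : Type*} [Field K] [DecidableEq K] {w : K} {m : ℕ}
    (hw : w ^ m = 1) : ∑ t ∈ Finset.range m, w ^ t = if w = 1 then (m : K) else 0 := by
  split_ifs with h
  · simp [h]
  · rw [geom_sum_eq h, hw, sub_self, zero_div]

lemma card_filter_digits_sum_modEq {q m : ℕ} (hq : 2 ≤ q) {ζ : ℂ} (hζ : IsPrimitiveRoot ζ m)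
    (hm : m ≠ 0) (b k : ℕ) :
    (m : ℂ) * ((Finset.range (q ^ k)).filter (fun n => (Nat.digits q n).sum ≡ b [MOD m])).card =
      ∑ t ∈ Finset.range m, ((ζ ^ t)⁻¹) ^ b * (∑ r ∈ Finset.range q, (ζ ^ t) ^ r) ^ k := by
  classical
  have h0 : ζ ≠ 0 := hζ.ne_zero hm
  have key : ∀ s : ℕ, ∑ t ∈ Finset.range m, ((ζ ^ t)⁻¹) ^ b * (ζ ^ t) ^ s =
      if s ≡ b [MOD m] then (m : ℂ) else 0 := by
    intro s
    have h1 : (ζ ^ s / ζ ^ b) ^ m = 1 := by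
      rw [div_pow, ← pow_mul, ← pow_mul, mul_comm s, mul_comm b, pow_mul, pow_mul, hζ.pow_eq_one]
      simp
    have h2 : ζ ^ s / ζ ^ b = 1 ↔ s ≡ b [MOD m] := by
      rw [div_eq_one_iff_eq (pow_ne_zero _ h0), hζ.eq_orderOf]
      exact (hζ.isOfFinOrder hm).pow_eq_pow_iff_modEq
    rw [← if_congr h2 rfl rfl, ← sum_pow_of_pow_eq_one h1]
    refine Finset.sum_congr rfl fun t _ => ?_
    rw [div_pow, inv_pow, ← pow_mul, ← pow_mul, ← pow_mul, ← pow_mul, mul_comm s, mul_comm b,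
      div_eq_mul_inv, mul_comm]
  simp_rw [← sum_pow_digits_sum hq, Finset.mul_sum]
  rw [Finset.sum_comm]
  simp_rw [key]
  rw [← Finset.sum_filter, Finset.sum_const, nsmul_eq_mul, mul_comm]

lemma sum_range_exp_two_mul_I_pow {y : ℝ} (hy : Real.sin y ≠ 0) (q : ℕ) :
    ∑ r ∈ Finset.range q, Complex.exp (2 * y * Complex.I) ^ r =
      ((Real.sin (q * y) / Real.sin y : ℝ) : ℂ) * Complex.exp ((q - 1) * y * Complex.I) := by
  have hs : Complex.sin y ≠ 0 := by exact_mod_cast hy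
  have hsub : ∀ u : ℂ, Complex.exp (2 * u * Complex.I) - 1 =
      2 * Complex.I * Complex.sin u * Complex.exp (u * Complex.I) := by
    intro u
    have e1 : Complex.exp (2 * u * Complex.I) =
        Complex.exp (u * Complex.I) * Complex.exp (u * Complex.I) := by
      rw [← Complex.exp_add]; ring_nf
    have e2 : Complex.exp (-u * Complex.I) * Complex.exp (u * Complex.I) = 1 := by
      rw [← Complex.exp_add]; simp
    rw [Complex.sin]
    linear_combination e1 + e2 + (Complex.exp (u * Complex.I) * Complex.exp (u * Complex.I)
      - Complex.exp (-u * Complex.I) * Complex.exp (u * Complex.I)) * Complex.I_mul_I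
  have h1 : Complex.exp (2 * y * Complex.I) - 1 ≠ 0 := by
    rw [hsub]
    simp [hs, Complex.exp_ne_zero]
  rw [geom_sum_eq (sub_ne_zero.mp h1), div_eq_iff h1, ← Complex.exp_nat_mul]
  rw [show (q : ℂ) * (2 * y * Complex.I) = 2 * (q * y) * Complex.I by ring, hsub, hsub]
  have e : Complex.exp (q * y * Complex.I) =
      Complex.exp ((q - 1) * y * Complex.I) * Complex.exp (y * Complex.I) := by
    rw [← Complex.exp_add]; ring_nf
  rw [e]
  push_cast
  field_simp

lemma exists_half_le_cos_nat_mul_sub {θ : ℝ} (hθ : 0 < θ) (hθ' : θ ≤ 2 * Real.pi / 3)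
    (α : ℝ) (M : ℕ) :
    ∃ k : ℕ, M < k ∧ 1 / 2 ≤ Real.cos (k * θ - α) := by
  obtain ⟨N, hN⟩ := exists_nat_gt ((M + 1) * θ - α + Real.pi / 3)
  have hpi := Real.pi_gt_three
  have hN' : (N : ℝ) ≤ N * (2 * Real.pi) :=
    le_mul_of_one_le_right N.cast_nonneg (by linarith)
  set X := (N * (2 * Real.pi) - Real.pi / 3 + α) / θ with hX
  have hXθ : X * θ = N * (2 * Real.pi) - Real.pi / 3 + α := div_mul_cancel₀ _ hθ.ne'
  have hMX : (M + 1 : ℝ) < X := by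
    rw [hX, lt_div_iff₀ hθ]; linarith
  have hk1 := Nat.le_ceil X
  have hk2 := Nat.ceil_lt_add_one (show 0 ≤ X by linarith [M.cast_nonneg (α := ℝ)])
  refine ⟨⌈X⌉₊, ?_, ?_⟩
  · have : (M : ℝ) < ⌈X⌉₊ := by linarith
    exact_mod_cast this
  · have l1 := mul_le_mul_of_nonneg_right hk1 hθ.le
    have l2 := mul_le_mul_of_nonneg_right hk2.le hθ.le
    rw [← Real.cos_sub_nat_mul_two_pi _ N, ← Real.cos_abs, ← Real.cos_pi_div_three]
    refine Real.cos_le_cos_of_nonneg_of_le_pi (abs_nonneg _) (by linarith) (abs_le.mpr ⟨?_, ?_⟩)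
    · linarith
    · linarith

lemma norm_sum_range_exp_two_mul_I_pow {y : ℝ} (hy : 0 < Real.sin y) (q : ℕ) :
    ‖∑ r ∈ Finset.range q, Complex.exp (2 * y * Complex.I) ^ r‖ =
      |Real.sin (q * y)| / Real.sin y := by
  have h : ((q : ℂ) - 1) * y * Complex.I = ((((q : ℝ) - 1) * y : ℝ) : ℂ) * Complex.I := by
    push_cast; ring
  rw [sum_range_exp_two_mul_I_pow hy.ne', h, norm_mul, Complex.norm_exp_ofReal_mul_I, mul_one,
    Complex.norm_real, Real.norm_eq_abs, abs_div, abs_of_pos hy]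

lemma abs_sin_div_sin_lt {q d t : ℕ} (hq : 2 ≤ q) (hd : 2 ≤ d) (ht : 2 ≤ t)
    (ht' : t + 2 ≤ d * q) {x : ℝ} (hx : (d * q : ℝ) * x = Real.pi) :
    |Real.sin (q * (t * x))| / Real.sin (t * x) < Real.sin (q * x) / Real.sin x := by
  have hq2 : (2 : ℝ) ≤ q := by exact_mod_cast hq
  have hd2 : (2 : ℝ) ≤ d := by exact_mod_cast hd
  have hx0 : 0 < x := by
    by_contra h
    have := mul_nonpos_of_nonneg_of_nonpos (show (0 : ℝ) ≤ d * q by positivity) (not_lt.mp h)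
    linarith [Real.pi_pos]
  have hnx : 2 * (q * x) ≤ Real.pi := by
    rw [← hx, mul_assoc]
    exact mul_le_mul_of_nonneg_right hd2 (by positivity)
  have hxq : x < Real.pi := by
    have := mul_le_mul_of_nonneg_right hq2 hx0.le
    linarith
  have hsx : 0 < Real.sin x := Real.sin_pos_of_pos_of_lt_pi hx0 hxq
  have half : ∀ u : ℕ, 2 ≤ u → 2 * u ≤ d * q →
      |Real.sin (q * (u * x))| / Real.sin (u * x) < Real.sin (q * x) / Real.sin x := by
    intro u hu hum
    have hu2 : (2 : ℝ) ≤ u := by exact_mod_cast hu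
    have hum' : 2 * (u : ℝ) ≤ d * q := by exact_mod_cast hum
    have h1 := mul_le_mul_of_nonneg_right hum' hx0.le
    have h2 := mul_le_mul_of_nonneg_right hu2 hx0.le
    have hsu : 0 < Real.sin (u * x) :=
      Real.sin_pos_of_pos_of_lt_pi (by positivity) (by linarith [Real.pi_pos])
    rw [div_lt_div_iff₀ hsu hsx]
    exact abs_sin_nat_mul_mul_sin_lt hq hx0 hnx (by linarith) (by linarith)
  rcases le_total (2 * t) (d * q) with h | h
  · exact half t ht h
  · have hr := half (d * q - t) (by omega) (by omega)
    rw [Nat.cast_sub (by omega), Nat.cast_mul, sub_mul, hx, mul_sub, Real.sin_pi_sub,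
      Real.sin_nat_mul_pi_sub] at hr
    simpa [abs_mul, abs_pow] using hr

/-- The number of `n < q ^ k` whose digit sum lies in a residue class modulo `d q` deviates
from the mean by the term of the two dominant characters, up to a smaller exponential. -/
lemma tendsto_digits_sum_error {q d : ℕ} (hq : 2 ≤ q) (hd : 2 ≤ d) (b : ℕ) {x : ℝ}
    (hx : (d * q : ℝ) * x = Real.pi) :
    Filter.Tendsto (fun k : ℕ =>
      ((d * q : ℝ) * ((Finset.range (q ^ k)).filter
          (fun n => (Nat.digits q n).sum ≡ b [MOD d * q])).card - (q : ℝ) ^ k) /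
        (Real.sin (q * x) / Real.sin x) ^ k
        - 2 * Real.cos (k * ((q - 1) * x) - 2 * b * x)) Filter.atTop (nhds 0) := by
  have hm4 : 4 ≤ d * q := Nat.mul_le_mul hd hq
  have hm0 : d * q ≠ 0 := by omega
  have hmR : (0 : ℝ) < d * q := by exact_mod_cast Nat.pos_of_ne_zero hm0
  have hx0 : 0 < x := by
    by_contra h
    have := mul_nonpos_of_nonneg_of_nonpos hmR.le (not_lt.mp h)
    linarith [Real.pi_pos]
  have hs : ∀ t : ℕ, 0 < t → t < d * q → 0 < Real.sin (t * x) := by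
    intro t ht htm
    have ht0 : (0 : ℝ) < t := by exact_mod_cast ht
    have htm' : (t : ℝ) < d * q := by exact_mod_cast htm
    refine Real.sin_pos_of_pos_of_lt_pi (by positivity) ?_
    rw [← hx]
    exact mul_lt_mul_of_pos_right htm' hx0
  have hsx : 0 < Real.sin x := by simpa using hs 1 one_pos (by omega)
  have hsq : 0 < Real.sin (q * x) := hs q (by omega) (by nlinarith)
  set R := Real.sin (q * x) / Real.sin x with hR
  have hR0 : 0 < R := div_pos hsq hsx
  set ζ := Complex.exp (2 * Real.pi * Complex.I / (d * q : ℕ)) with hζdef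
  have hζ : IsPrimitiveRoot ζ (d * q) := Complex.isPrimitiveRoot_exp _ hm0
  have hζx : ∀ t : ℕ, ζ ^ t = Complex.exp (2 * (t * x : ℝ) * Complex.I) := by
    intro t
    rw [hζdef, ← Complex.exp_nat_mul, ← hx]
    have hdC : (d : ℂ) ≠ 0 := by exact_mod_cast (by omega : d ≠ 0)
    have hqC : (q : ℂ) ≠ 0 := by exact_mod_cast (by omega : q ≠ 0)
    congr 1
    push_cast
    field_simp
  have hconj : (starRingEnd ℂ) ζ = ζ ^ (d * q - 1) := by
    have h1 : ζ * ζ ^ (d * q - 1) = 1 := by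
      rw [← pow_succ', Nat.sub_add_cancel (by omega), hζ.pow_eq_one]
    rw [← Complex.inv_eq_conj (hζ.norm'_eq_one hm0)]
    exact inv_eq_of_mul_eq_one_right h1
  set f : ℕ → ℕ → ℂ := fun t k =>
    ((ζ ^ t)⁻¹) ^ b * (∑ r ∈ Finset.range q, (ζ ^ t) ^ r) ^ k with hf
  have hf0 : ∀ k, f 0 k = (q : ℂ) ^ k := by intro k; simp [hf]
  have hf1 : ∀ k : ℕ, (f 1 k).re = R ^ k * Real.cos (k * ((q - 1) * x) - 2 * b * x) := by
    intro k
    have e := sum_range_exp_two_mul_I_pow hsx.ne' q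
    have e1 : f 1 k = ((R ^ k : ℝ) : ℂ) *
        Complex.exp ((k * ((q - 1) * x) - 2 * b * x : ℝ) * Complex.I) := by
      simp only [hf]
      rw [hζx, Nat.cast_one, one_mul, e, ← hR, mul_pow, ← Complex.exp_neg, ← Complex.exp_nat_mul,
        ← Complex.exp_nat_mul, mul_left_comm, ← Complex.exp_add]
      push_cast
      ring_nf
    rw [e1, Complex.re_ofReal_mul, Complex.exp_ofReal_mul_I_re]
  have hfm : ∀ k, (f (d * q - 1) k).re = (f 1 k).re := by
    intro k
    have : f (d * q - 1) k = (starRingEnd ℂ) (f 1 k) := by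
      simp only [hf]
      rw [← hconj]
      simp
    rw [this, Complex.conj_re]
  have hfn : ∀ t k, ‖f t k‖ = ‖∑ r ∈ Finset.range q, (ζ ^ t) ^ r‖ ^ k := by
    intro t k
    simp [hf, hζ.norm'_eq_one hm0]
  have hrest : ∀ t ∈ Finset.Ico 2 (d * q - 1),
      Filter.Tendsto (fun k => (f t k).re / R ^ k) Filter.atTop (nhds 0) := by
    intro t ht
    rw [Finset.mem_Ico] at ht
    have hlt : ‖∑ r ∈ Finset.range q, (ζ ^ t) ^ r‖ / R < 1 := by
      rw [div_lt_one hR0, hζx, norm_sum_range_exp_two_mul_I_pow (hs t (by omega) (by omega))]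
      exact abs_sin_div_sin_lt hq hd ht.1 (by omega) hx
    refine squeeze_zero_norm (fun k => ?_)
      (tendsto_pow_atTop_nhds_zero_of_lt_one (by positivity) hlt)
    rw [norm_div, norm_pow, Real.norm_of_nonneg hR0.le, div_pow _ R, ← hfn, Real.norm_eq_abs]
    gcongr
    exact Complex.abs_re_le_norm _
  have hsum := tendsto_finsetSum (Finset.Ico 2 (d * q - 1)) hrest
  rw [Finset.sum_const_zero] at hsum
  refine hsum.congr fun k => ?_
  have hcard := congrArg Complex.re (card_filter_digits_sum_modEq hq hζ hm0 b k)
  change _ = (∑ t ∈ Finset.range (d * q), f t k).re at hcard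
  have hsplit : ∑ t ∈ Finset.range (d * q), f t k =
      f 0 k + f 1 k + ∑ t ∈ Finset.Ico 2 (d * q - 1), f t k + f (d * q - 1) k := by
    have h : d * q = d * q - 1 + 1 := by omega
    rw [h, Finset.sum_range_succ, ← h,
      ← Finset.sum_range_add_sum_Ico _ (show 2 ≤ d * q - 1 by omega)]
    simp [Finset.sum_range_succ]
  rw [hsplit, Complex.add_re, Complex.add_re, Complex.add_re, hfm, hf1, hf0, Complex.re_sum,
    ← Complex.ofReal_natCast q, ← Complex.ofReal_pow, Complex.ofReal_re, ← Nat.cast_mul,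
    Complex.natCast_re] at hcard
  push_cast at hcard
  rw [hcard, ← Finset.sum_div]
  have := (pow_pos hR0 k).ne'
  field_simp
  ring

/-- Case `d ∣ q − 1`: there exist `R > 1` and `c > 0` such that the error
`E_{a,j}(k) − q^{k−1}/d` exceeds `c·R^k` for infinitely many `k` and is below
`−c·R^k` for infinitely many `k`. -/
theorem error_oscillates_exponentially (q d : ℕ) (hq : 2 ≤ q) (hd : 2 ≤ d)
    (hdq : d ∣ q - 1) (a j : ℕ) (ha : a < d) (hj : j < q) :
    ∃ R : ℝ, 1 < R ∧ ∃ c : ℝ, 0 < c ∧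
      (∀ M : ℕ, ∃ k : ℕ, M < k ∧
        c * R ^ k <
          ((((Finset.range (q ^ k)).filter
                (fun n => n % d = a ∧ (Nat.digits q n).sum % q = j)).card : ℝ)
              - (q : ℝ) ^ (k - 1) / d)) ∧
      (∀ M : ℕ, ∃ k : ℕ, M < k ∧
        ((((Finset.range (q ^ k)).filter
              (fun n => n % d = a ∧ (Nat.digits q n).sum % q = j)).card : ℝ)
            - (q : ℝ) ^ (k - 1) / d) < -(c * R ^ k)) := by
  have hq1 : q % d = 1 := by
    obtain ⟨e, he⟩ := hdq
    rw [show q = 1 + d * e by omega, Nat.add_mul_mod_self_left, Nat.mod_eq_of_lt (by omega)]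
  have hco : Nat.Coprime d q := by
    rw [Nat.coprime_iff_gcd_eq_one, Nat.gcd_rec, hq1, Nat.gcd_one_left]
  obtain ⟨b, hbd, hbq⟩ := Nat.chineseRemainder hco a j
  have hiff : ∀ n : ℕ, (n % d = a ∧ (Nat.digits q n).sum % q = j) ↔
      (Nat.digits q n).sum ≡ b [MOD d * q] := by
    intro n
    rw [← Nat.modEq_and_modEq_iff_modEq_mul hco]
    have h1 : n % d = (Nat.digits q n).sum % d := Nat.modEq_digits_sum d q hq1 n
    unfold Nat.ModEq at *
    rw [hbd, hbq, Nat.mod_eq_of_lt ha, Nat.mod_eq_of_lt hj, h1]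
  simp_rw [hiff]
  have hqR : (2 : ℝ) ≤ q := by exact_mod_cast hq
  have hdR : (2 : ℝ) ≤ d := by exact_mod_cast hd
  have hm : (0 : ℝ) < d * q := by positivity
  set x := Real.pi / (d * q) with hxdef
  have hx : (d * q : ℝ) * x = Real.pi := by rw [hxdef]; field_simp
  have hx0 : 0 < x := div_pos Real.pi_pos hm
  have hnx : 2 * (q * x) ≤ Real.pi := by
    rw [← hx, mul_assoc]
    exact mul_le_mul_of_nonneg_right hdR (by positivity)
  have hxq : 2 * x ≤ q * x := mul_le_mul_of_nonneg_right hqR hx0.le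
  have hsx : 0 < Real.sin x := Real.sin_pos_of_pos_of_lt_pi hx0 (by linarith)
  have hR : 1 < Real.sin (q * x) / Real.sin x := by
    rw [one_lt_div hsx]
    exact Real.sin_lt_sin_of_lt_of_le_pi_div_two (by linarith) (by linarith) (by linarith)
  have htend := tendsto_digits_sum_error hq hd b hx
  set R := Real.sin (q * x) / Real.sin x
  obtain ⟨K, hK⟩ := (Metric.tendsto_atTop.mp htend) (1 / 4) (by norm_num)
  have hθ : 0 < ((q : ℝ) - 1) * x := mul_pos (by linarith) hx0
  have hθ' : ((q : ℝ) - 1) * x ≤ 2 * Real.pi / 3 := by linarith [Real.pi_pos]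
  have herr : ∀ k : ℕ, 1 ≤ k → ∀ e : ℝ,
      e - (q : ℝ) ^ (k - 1) / d = ((d * q : ℝ) * e - (q : ℝ) ^ k) / R ^ k * R ^ k / (d * q) := by
    intro k hk e
    rw [div_mul_cancel₀ _ (pow_pos (by linarith) k).ne', ← Nat.sub_add_cancel hk, pow_succ,
      Nat.add_sub_cancel]
    field_simp
  refine ⟨R, hR, 1 / 2 / (d * q), by positivity, fun M => ?_, fun M => ?_⟩
  · obtain ⟨k, hk, hcos⟩ := exists_half_le_cos_nat_mul_sub hθ hθ' (2 * b * x) (max M K)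
    have hlt := abs_lt.mp (by simpa [Real.dist_eq] using hK k (by omega))
    refine ⟨k, by omega, ?_⟩
    rw [herr k (by omega), div_mul_eq_mul_div (1 / 2 : ℝ)]
    refine div_lt_div_of_pos_right (mul_lt_mul_of_pos_right ?_ (pow_pos (by linarith) k)) hm
    linarith [hlt.1]
  · obtain ⟨k, hk, hcos⟩ :=
      exists_half_le_cos_nat_mul_sub hθ hθ' (2 * b * x + Real.pi) (max M K)
    rw [← sub_sub, Real.cos_sub_pi] at hcos
    have hlt := abs_lt.mp (by simpa [Real.dist_eq] using hK k (by omega))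
    refine ⟨k, by omega, ?_⟩
    rw [herr k (by omega), div_mul_eq_mul_div (1 / 2 : ℝ), ← neg_div, ← neg_mul]
    refine div_lt_div_of_pos_right (mul_lt_mul_of_pos_right ?_ (pow_pos (by linarith) k)) hm
    linarith [hlt.2]
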